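/- Proposition 5(2): In the left-censored disclosure model, in every truth-leaning equilibrium (σ, a, μ): for all e ∈ E, σ(e|e) = 1 if and only if D(e) ≥ N(e) − n*, where n* = log_{p/q}((p−α)/(q−α)) − 1. -/

import Mathlib

open scoped BigOperators

namespace LeftCensored

/-- Evidence: a finite sequence of binary signals; `true` stands for a high
return (`g`) and `false` for a low return (`b`). A sequence is a list whose
suffixes are the most recent signals. -/
abbrev Ev := List Bool

/-- `G(e)`: the number of `g`'s in `e`. -/
def Gc (e : Ev) : ℕ := e.count true

/-- `B(e)`: the number of `b`'s in `e`. -/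
def Bc (e : Ev) : ℕ := e.count false

/-- `D(e) = G(e) − B(e)`. -/
def D (e : Ev) : ℤ := (Gc e : ℤ) - (Bc e : ℤ)

/-- `N(e) = max_{0 ≤ k ≤ L(e)} D(e|_k)`, the maximum of `D` over all suffixes
(truncations from the left) of `e`; since the empty suffix gives `D = 0`, this
equals the fold of `max` over the suffixes starting from `0`. -/
def N (e : Ev) : ℤ := (e.tails.map D).foldr max 0

/-- The evidence distribution in the good state. -/
noncomputable def FG (p q : ℝ) (e : Ev) : ℝ := (1 - p - q) * p ^ Gc e * q ^ Bc e

/-- The evidence distribution in the bad state. -/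
noncomputable def FB (p q : ℝ) (e : Ev) : ℝ := (1 - p - q) * p ^ Bc e * q ^ Gc e

/-- Posterior belief `ν(A)` that the state is good given evidence in `A`. -/
noncomputable def nu (p q π0 : ℝ) (A : Set Ev) : ℝ :=
  ((∑' e : A, FG p q e) * π0) /
    ((∑' e : A, FG p q e) * π0 + (∑' e : A, FB p q e) * (1 - π0))

/-- `α = (1 − √(1 − 4pq))/2`. -/
noncomputable def alpha (p q : ℝ) : ℝ := (1 - Real.sqrt (1 - 4 * p * q)) / 2

/-- The sender's equilibrium value function (Proposition 4). -/
noncomputable def V (p q π0 : ℝ) (e : Ev) : ℝ :=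
  1 / (1 + ((1 - π0) / π0) * ((p - alpha p q) / (q - alpha p q)) * (q / p) ^ (N e + 1))

/-- `L` is a (nonempty) lower contour set in `A` with respect to the suffix
(left-censoring) order. -/
def IsLCS (A L : Set Ev) : Prop :=
  L.Nonempty ∧ L ⊆ A ∧ ∀ e ∈ L, ∀ e' ∈ A, e' <:+ e → e' ∈ L

/-- A truth-leaning equilibrium of the left-censored disclosure game (the
receiver's response `φ` is the identity). -/
structure Eqm (p q π0 : ℝ) where
  σ : Ev → Ev → ℝ
  act : Ev → ℝ
  μ : Ev → ℝ
  σ_nonneg : ∀ e m, 0 ≤ σ e m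
  σ_hasSum : ∀ e, HasSum (σ e) 1
  feasible : ∀ e m, 0 < σ e m → m <:+ e
  μ_mem : ∀ m, μ m ∈ Set.Icc (0 : ℝ) 1
  sender_opt : ∀ e m, 0 < σ e m → ∀ m', m' <:+ e → act m' ≤ act m
  receiver_opt : ∀ m, act m = μ m
  bayes : ∀ m, (∃ e, 0 < σ e m) →
    μ m = (∑' e : {e : Ev // m <:+ e}, σ e.1 m * FG p q e.1 * π0) /
      (∑' e : {e : Ev // m <:+ e}, σ e.1 m * (FG p q e.1 * π0 + FB p q e.1 * (1 - π0)))
  truth_leaning : ∀ e, (∀ m, m <:+ e → act m ≤ act e) → σ e e = 1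
  offpath : ∀ m, (¬ ∃ e, 0 < σ e m) → μ m = nu p q π0 {m}

end LeftCensored

namespace LeftCensored

/-- `n* = log_{p/q}((p−α)/(q−α)) − 1`. -/
noncomputable def nstar (p q : ℝ) : ℝ :=
  Real.log ((p - alpha p q) / (q - alpha p q)) / Real.log (p / q) - 1

@[simp] lemma Gc_nil : Gc [] = 0 := rfl
@[simp] lemma Bc_nil : Bc [] = 0 := rfl
@[simp] lemma Gc_cons_true (e : Ev) : Gc (true :: e) = Gc e + 1 := by simp [Gc]
@[simp] lemma Gc_cons_false (e : Ev) : Gc (false :: e) = Gc e := by simp [Gc]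
@[simp] lemma Bc_cons_true (e : Ev) : Bc (true :: e) = Bc e := by simp [Bc]
@[simp] lemma Bc_cons_false (e : Ev) : Bc (false :: e) = Bc e + 1 := by simp [Bc]

lemma D_cons_true (e : Ev) : D (true :: e) = D e + 1 := by simp [D]; ring
lemma D_cons_false (e : Ev) : D (false :: e) = D e - 1 := by simp [D]; ring

lemma N_cons (a : Bool) (e : Ev) : N (a :: e) = max (D (a :: e)) (N e) := by
  simp [N]

lemma N_nonneg (e : Ev) : 0 ≤ N e := by
  induction e with
  | nil => simp [N]
  | cons a e ih => rw [N_cons]; exact le_max_of_le_right ih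

lemma D_le_N (e : Ev) : D e ≤ N e := by
  cases e with
  | nil => simp [N, D]
  | cons a e => rw [N_cons]; exact le_max_left _ _

lemma N_le_of_suffix {m e : Ev} (h : m <:+ e) : N m ≤ N e := by
  induction e with
  | nil => simp_all
  | cons a e ih =>
    rcases List.suffix_cons_iff.1 h with rfl | h
    · exact le_rfl
    · rw [N_cons]; exact le_max_of_le_right (ih h)

lemma alpha_sq {p q : ℝ} (hpq : 4 * p * q ≤ 1) :
    alpha p q ^ 2 = alpha p q - p * q := by
  have := Real.sq_sqrt (show 0 ≤ 1 - 4 * p * q by linarith)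
  unfold alpha
  linear_combination this / 4

lemma alpha_pos {p q : ℝ} (hq0 : 0 < q) (hp0 : 0 < p) : 0 < alpha p q := by
  have : Real.sqrt (1 - 4 * p * q) < 1 := by
    rw [Real.sqrt_lt' one_pos]; nlinarith [mul_pos hp0 hq0]
  unfold alpha
  linarith

lemma alpha_lt {p q : ℝ} (hq0 : 0 < q) (hpq1 : p + q < 1) : alpha p q < q := by
  have : 1 - 2 * q < Real.sqrt (1 - 4 * p * q) := by
    apply Real.lt_sqrt_of_sq_lt
    nlinarith
  unfold alpha
  linarith

/-- The divided difference `(x ^ n - a ^ n) / (x - a)` is monotone in `x`. -/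
lemma sub_mul_pow_sub_pow_le {a x y : ℝ} (ha : 0 ≤ a) (hax : a ≤ x) (hxy : x ≤ y) (n : ℕ) :
    (y - a) * (x ^ n - a ^ n) ≤ (x - a) * (y ^ n - a ^ n) := by
  rw [← geom_sum₂_mul, ← geom_sum₂_mul]
  have hx : 0 ≤ x := ha.trans hax
  have key : ∑ i ∈ Finset.range n, x ^ i * a ^ (n - 1 - i) ≤
      ∑ i ∈ Finset.range n, y ^ i * a ^ (n - 1 - i) := by
    gcongr
  have := mul_le_mul_of_nonneg_left key
    (mul_nonneg (sub_nonneg.2 hax) (sub_nonneg.2 (hax.trans hxy)))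
  linarith

lemma summable_pow_mul_pow {x y : ℝ} (hx : 0 ≤ x) (hy : 0 ≤ y) (hxy : x + y < 1) :
    Summable fun e : Ev => x ^ Gc e * y ^ Bc e := by
  have hprod : ∀ e : Ev, x ^ Gc e * y ^ Bc e = (e.map fun b => if b then x else y).prod := by
    intro e
    induction e with
    | nil => simp
    | cons a e ih => cases a <;> simp [← ih, pow_succ] <;> ring
  rw [← List.equivSigmaTuple.symm.summable_iff, summable_sigma_of_nonneg]
  · refine ⟨fun n => Summable.of_finite, ?_⟩
    have : ∀ n : ℕ, ∑' c : Fin n → Bool,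
        ((fun e : Ev => x ^ Gc e * y ^ Bc e) ∘ List.equivSigmaTuple.symm) ⟨n, c⟩
          = (x + y) ^ n := by
      intro n
      rw [tsum_fintype]
      have := Fintype.sum_pow (fun b : Bool => if b then x else y) n
      simp only [Fintype.sum_bool, if_true] at this
      simp only [Function.comp, hprod]
      simp only [Bool.false_eq_true, if_false] at this
      rw [this]
      refine Finset.sum_congr rfl fun c _ => ?_
      simp [List.equivSigmaTuple, List.map_ofFn, List.prod_ofFn]
    simp only [this]
    exact summable_geometric_of_lt_one (by positivity) hxy
  · intro z; simp only [Function.comp]; positivity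

lemma summable_mul_of_abs_le_one {c w : Ev → ℝ} (hc : Summable c) (hw : ∀ e, |w e| ≤ 1) :
    Summable fun e => c e * w e := by
  refine Summable.of_norm_bounded hc.norm fun e => ?_
  rw [norm_mul]
  exact mul_le_of_le_one_right (norm_nonneg _) (hw e)

lemma abs_sub_le_one_of_mem_Icc {a b : ℝ} (ha : a ∈ Set.Icc (0 : ℝ) 1)
    (hb : b ∈ Set.Icc (0 : ℝ) 1) : |a - b| ≤ 1 :=
  abs_le.2 ⟨by linarith [ha.1, hb.2], by linarith [ha.2, hb.1]⟩

lemma tsum_eq_nil_add {h : Ev → ℝ} (hs : Summable h) :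
    ∑' e, h e = h [] + ∑' e, (h (true :: e) + h (false :: e)) := by
  have h1 : Summable fun e => h (true :: e) :=
    hs.comp_injective (i := fun e : Ev => true :: e) fun _ _ h => by simpa using h
  have h2 : Summable fun e => h (false :: e) :=
    hs.comp_injective (i := fun e : Ev => false :: e) fun _ _ h => by simpa using h
  let eqv : Unit ⊕ (Ev ⊕ Ev) ≃ Ev :=
    { toFun := Sum.elim (fun _ => []) (Sum.elim (List.cons true) (List.cons false))
      invFun := fun e => match e with
        | [] => Sum.inl ()
        | true :: e => Sum.inr (Sum.inl e)
        | false :: e => Sum.inr (Sum.inr e)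
      left_inv := by rintro (_ | _ | _) <;> rfl
      right_inv := by rintro (_ | ⟨_ | _, _⟩) <;> rfl }
  rw [← eqv.tsum_eq, Summable.tsum_sum, Summable.tsum_sum, h1.tsum_add h2]
  · simp [eqv]
  · exact h1
  · exact h2
  · exact Summable.of_finite
  · exact (eqv.summable_iff.2 hs).comp_injective Sum.inr_injective


/-- The gap `N e - D e`, as a natural number. -/
def gap (e : Ev) : ℕ := (N e - D e).toNat

lemma coe_gap (e : Ev) : (gap e : ℤ) = N e - D e :=
  Int.toNat_of_nonneg (sub_nonneg.2 (D_le_N e))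

lemma Gc_add_gap (e : Ev) : Gc e + gap e = (N e).toNat + Bc e := by
  have h1 := coe_gap e
  have h2 := N_nonneg e
  unfold D at h1
  omega

lemma gap_eq_zero_of_N_cons_ne {a : Bool} {e : Ev} (h : N (a :: e) ≠ N e) :
    gap (a :: e) = 0 := by
  have h1 := coe_gap (a :: e)
  rw [N_cons] at h h1
  omega

lemma gap_cons_true {e : Ev} {k : ℕ} (h : gap e = k + 1) :
    N (true :: e) = N e ∧ gap (true :: e) = k := by
  have h1 := coe_gap (true :: e)
  have h2 := coe_gap e
  rw [N_cons, D_cons_true] at *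
  omega

lemma gap_cons_true_of_eq_zero {e : Ev} (h : gap e = 0) : gap (true :: e) = 0 := by
  have h1 := coe_gap (true :: e)
  have h2 := coe_gap e
  rw [N_cons, D_cons_true] at *
  omega

lemma gap_cons_false (e : Ev) :
    N (false :: e) = N e ∧ gap (false :: e) = gap e + 1 := by
  have h1 := coe_gap (false :: e)
  have h2 := coe_gap e
  rw [N_cons, D_cons_false] at *
  omega

/-- The total probability of `e` in the two states of the world. -/
noncomputable def wt (p q π0 : ℝ) (e : Ev) : ℝ :=
  FG p q e * π0 + FB p q e * (1 - π0)

/-- The closed form of the sum of `wt * (ν - V)` over all extensions of `e`. -/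
noncomputable def excess (p q π0 : ℝ) (e : Ev) : ℝ :=
  π0 * (1 - V p q π0 e) * (p ^ Gc e * q ^ Bc e) * (1 - (alpha p q / q) ^ (gap e + 1)) -
    (1 - π0) * V p q π0 e * (p ^ Bc e * q ^ Gc e) * (1 - (alpha p q / p) ^ (gap e + 1))

section
variable {p q π0 : ℝ}

lemma FG_pos (hq0 : 0 < q) (hp0 : 0 < p) (hpq1 : p + q < 1) (e : Ev) : 0 < FG p q e := by
  have : 0 < 1 - p - q := by linarith
  unfold FG; positivity

lemma FB_pos (hq0 : 0 < q) (hp0 : 0 < p) (hpq1 : p + q < 1) (e : Ev) : 0 < FB p q e := by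
  have : 0 < 1 - p - q := by linarith
  unfold FB; positivity

lemma wt_pos (hq0 : 0 < q) (hp0 : 0 < p) (hpq1 : p + q < 1) (h0 : 0 < π0) (h1 : π0 < 1)
    (e : Ev) : 0 < wt p q π0 e := by
  have := FG_pos hq0 hp0 hpq1 e
  have := FB_pos hq0 hp0 hpq1 e
  have : 0 < 1 - π0 := by linarith
  unfold wt; positivity

lemma summable_pow_mul_pow_swap {x y : ℝ} (hx : 0 ≤ x) (hy : 0 ≤ y) (hxy : x + y < 1) :
    Summable fun e : Ev => x ^ Bc e * y ^ Gc e := by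
  simpa only [mul_comm] using summable_pow_mul_pow hy hx (by linarith)

lemma summable_wt (hq0 : 0 < q) (hp0 : 0 < p) (hpq1 : p + q < 1) :
    Summable (wt p q π0) := by
  have hG := summable_pow_mul_pow hp0.le hq0.le hpq1
  have hB := summable_pow_mul_pow_swap hp0.le hq0.le hpq1
  refine ((hG.mul_left ((1 - p - q) * π0)).add
    (hB.mul_left ((1 - p - q) * (1 - π0)))).congr fun e => ?_
  unfold wt FG FB; ring

lemma nu_singleton (e : Ev) : nu p q π0 {e} = FG p q e * π0 / wt p q π0 e := by
  unfold nu wt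
  rw [tsum_singleton e (FG p q), tsum_singleton e (FB p q)]

lemma wt_mul_nu (hq0 : 0 < q) (hp0 : 0 < p) (hpq1 : p + q < 1) (h0 : 0 < π0) (h1 : π0 < 1)
    (e : Ev) : wt p q π0 e * nu p q π0 {e} = FG p q e * π0 := by
  rw [nu_singleton, mul_div_cancel₀ _ (wt_pos hq0 hp0 hpq1 h0 h1 e).ne']

lemma V_eq_div (hq0 : 0 < q) (hqp : q < p) (hpq1 : p + q < 1) (h0 : 0 < π0) (h1 : π0 < 1)
    (e : Ev) : V p q π0 e = π0 * (q - alpha p q) * p ^ ((N e).toNat + 1) /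
      (π0 * (q - alpha p q) * p ^ ((N e).toNat + 1) +
        (1 - π0) * (p - alpha p q) * q ^ ((N e).toNat + 1)) := by
  have hp0 : 0 < p := hq0.trans hqp
  have hα : 0 < q - alpha p q := sub_pos.2 (alpha_lt hq0 hpq1)
  have hα' : 0 < p - alpha p q := by linarith
  have h1' : 0 < 1 - π0 := by linarith
  have hN : N e + 1 = (((N e).toNat + 1 : ℕ) : ℤ) := by
    push_cast; rw [Int.toNat_of_nonneg (N_nonneg e)]
  unfold V
  rw [hN, zpow_natCast, div_pow]
  field_simp

lemma V_mul_eq (hq0 : 0 < q) (hqp : q < p) (hpq1 : p + q < 1) (h0 : 0 < π0) (h1 : π0 < 1)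
    (e : Ev) : V p q π0 e * ((1 - π0) * (p - alpha p q) * q ^ ((N e).toNat + 1)) =
      (1 - V p q π0 e) * (π0 * (q - alpha p q) * p ^ ((N e).toNat + 1)) := by
  have hp0 : 0 < p := hq0.trans hqp
  have hα : 0 < q - alpha p q := sub_pos.2 (alpha_lt hq0 hpq1)
  have hα' : 0 < p - alpha p q := by linarith
  have h1' : 0 < 1 - π0 := by linarith
  rw [V_eq_div hq0 hqp hpq1 h0 h1]
  field_simp
  ring

lemma V_pos (hq0 : 0 < q) (hqp : q < p) (hpq1 : p + q < 1) (h0 : 0 < π0) (h1 : π0 < 1)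
    (e : Ev) : 0 < V p q π0 e := by
  have hp0 : 0 < p := hq0.trans hqp
  have hα : 0 < q - alpha p q := sub_pos.2 (alpha_lt hq0 hpq1)
  have hα' : 0 < p - alpha p q := by linarith
  have h1' : 0 < 1 - π0 := by linarith
  rw [V_eq_div hq0 hqp hpq1 h0 h1]
  positivity

lemma V_lt_one (hq0 : 0 < q) (hqp : q < p) (hpq1 : p + q < 1) (h0 : 0 < π0) (h1 : π0 < 1)
    (e : Ev) : V p q π0 e < 1 := by
  have hp0 : 0 < p := hq0.trans hqp
  have hα : 0 < q - alpha p q := sub_pos.2 (alpha_lt hq0 hpq1)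
  have hα' : 0 < p - alpha p q := by linarith
  have h1' : 0 < 1 - π0 := by linarith
  rw [V_eq_div hq0 hqp hpq1 h0 h1, div_lt_one (by positivity)]
  have : 0 < (1 - π0) * (p - alpha p q) * q ^ ((N e).toNat + 1) := by positivity
  linarith

lemma V_congr {e e' : Ev} (h : N e = N e') : V p q π0 e = V p q π0 e' := by
  unfold V; rw [h]

lemma V_mono (hq0 : 0 < q) (hqp : q < p) (hpq1 : p + q < 1) (h0 : 0 < π0) (h1 : π0 < 1)
    {m e : Ev} (h : m <:+ e) : V p q π0 m ≤ V p q π0 e := by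
  have hp0 : 0 < p := hq0.trans hqp
  have hα : 0 < q - alpha p q := sub_pos.2 (alpha_lt hq0 hpq1)
  have hα' : 0 < p - alpha p q := by linarith
  have h1' : 0 < 1 - π0 := by linarith
  have hN := N_le_of_suffix h
  have hz : (q / p) ^ (N e + 1) ≤ (q / p) ^ (N m + 1) :=
    zpow_le_zpow_right_of_le_one₀ (by positivity) ((div_le_one hp0).2 hqp.le) (by linarith)
  unfold V
  gcongr

/-- `excess e` has the sign of
`(p - α) * (q ^ (k + 1) - α ^ (k + 1)) - (q - α) * (p ^ (k + 1) - α ^ (k + 1))`, `k = gap e`. -/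
lemma excess_mul_eq (hq0 : 0 < q) (hqp : q < p) (hpq1 : p + q < 1) (h0 : 0 < π0) (h1 : π0 < 1)
    (e : Ev) :
    excess p q π0 e * ((p - alpha p q) * q ^ (gap e + 1)) =
      π0 * (1 - V p q π0 e) * (p ^ Gc e * q ^ Bc e) *
        ((p - alpha p q) * (q ^ (gap e + 1) - alpha p q ^ (gap e + 1)) -
          (q - alpha p q) * (p ^ (gap e + 1) - alpha p q ^ (gap e + 1))) := by
  have hp0 : 0 < p := hq0.trans hqp
  have hV := V_mul_eq hq0 hqp hpq1 h0 h1 e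
  have hg := Gc_add_gap e
  unfold excess
  generalize V p q π0 e = v at *
  generalize alpha p q = a at *
  generalize gap e = k at *
  generalize (N e).toNat = n at *
  generalize Gc e = G at *
  generalize Bc e = B at *
  have hkey : p ^ B * q ^ G * q ^ (k + 1) = q ^ B * p ^ B * q ^ (n + 1) := by
    have : q ^ G * q ^ (k + 1) = q ^ B * q ^ (n + 1) := by
      rw [← pow_add, ← pow_add]; congr 1; omega
    linear_combination p ^ B * this
  have hkey2 : p ^ B * p ^ (n + 1) = p ^ G * p ^ (k + 1) := by
    rw [← pow_add, ← pow_add]; congr 1; omega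
  have e1 : (1 - (a / q) ^ (k + 1)) * q ^ (k + 1) = q ^ (k + 1) - a ^ (k + 1) := by
    rw [div_pow]; field_simp
  have e2 : (1 - (a / p) ^ (k + 1)) * p ^ (k + 1) = p ^ (k + 1) - a ^ (k + 1) := by
    rw [div_pow]; field_simp
  rw [← e1, ← e2]
  linear_combination
    (-(1 - π0) * v * (1 - (a / p) ^ (k + 1)) * (p - a)) * hkey
    - (1 - (a / p) ^ (k + 1)) * q ^ B * p ^ B * hV
    - (1 - (a / p) ^ (k + 1)) * q ^ B * (1 - v) * π0 * (q - a) * hkey2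

lemma excess_nonpos (hq0 : 0 < q) (hqp : q < p) (hpq1 : p + q < 1) (h0 : 0 < π0) (h1 : π0 < 1)
    (e : Ev) : excess p q π0 e ≤ 0 := by
  have hp0 : 0 < p := hq0.trans hqp
  have ha := alpha_pos hq0 hp0
  have hα := alpha_lt hq0 hpq1
  have hV := V_lt_one hq0 hqp hpq1 h0 h1 e
  refine nonpos_of_mul_nonpos_left (b := (p - alpha p q) * q ^ (gap e + 1)) ?_
    (mul_pos (by linarith) (by positivity))
  rw [excess_mul_eq hq0 hqp hpq1 h0 h1]
  refine mul_nonpos_of_nonneg_of_nonpos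
    (mul_nonneg (mul_nonneg h0.le (by linarith)) (by positivity)) ?_
  have := sub_mul_pow_sub_pow_le ha.le hα.le hqp.le (gap e + 1)
  linarith

lemma excess_eq_zero (hq0 : 0 < q) (hqp : q < p) (hpq1 : p + q < 1) (h0 : 0 < π0) (h1 : π0 < 1)
    {e : Ev} (he : gap e = 0) : excess p q π0 e = 0 := by
  have hα := alpha_lt hq0 hpq1
  have h := excess_mul_eq hq0 hqp hpq1 h0 h1 e
  simp only [he, zero_add, pow_one] at h
  have hne : (p - alpha p q) * q ≠ 0 := mul_ne_zero (by linarith) hq0.ne'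
  refine (mul_eq_zero.1 (h.trans ?_)).resolve_right hne
  ring

lemma excess_cons_true (hq0 : 0 < q) (hqp : q < p) (hpq1 : p + q < 1) (h0 : 0 < π0)
    (h1 : π0 < 1) (e : Ev) : excess p q π0 (true :: e) =
      π0 * (1 - V p q π0 e) * (p ^ (Gc e + 1) * q ^ Bc e) * (1 - (alpha p q / q) ^ gap e) -
        (1 - π0) * V p q π0 e * (p ^ Bc e * q ^ (Gc e + 1)) *
          (1 - (alpha p q / p) ^ gap e) := by
  rcases hk : gap e with _ | k
  · rw [excess_eq_zero hq0 hqp hpq1 h0 h1 (gap_cons_true_of_eq_zero hk)]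
    simp
  · obtain ⟨hN, hg⟩ := gap_cons_true hk
    rw [excess, V_congr hN, hg, Gc_cons_true, Bc_cons_true]

lemma excess_cons_false (e : Ev) : excess p q π0 (false :: e) =
      π0 * (1 - V p q π0 e) * (p ^ Gc e * q ^ (Bc e + 1)) *
          (1 - (alpha p q / q) ^ (gap e + 2)) -
        (1 - π0) * V p q π0 e * (p ^ (Bc e + 1) * q ^ Gc e) *
          (1 - (alpha p q / p) ^ (gap e + 2)) := by
  obtain ⟨hN, hg⟩ := gap_cons_false e
  rw [excess, V_congr hN, hg, Gc_cons_false, Bc_cons_false]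

lemma wt_mul_nu_sub_V (hq0 : 0 < q) (hqp : q < p) (hpq1 : p + q < 1) (h0 : 0 < π0)
    (h1 : π0 < 1) (e : Ev) :
    wt p q π0 e * (nu p q π0 {e} - V p q π0 e) =
      excess p q π0 e - excess p q π0 (true :: e) - excess p q π0 (false :: e) := by
  have hp0 : 0 < p := hq0.trans hqp
  have hsq := alpha_sq (p := p) (q := q) (by nlinarith [sq_nonneg (p - q)])
  rw [mul_sub, wt_mul_nu hq0 hp0 hpq1 h0 h1, excess_cons_true hq0 hqp hpq1 h0 h1,
    excess_cons_false, excess, wt, FG, FB]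
  generalize V p q π0 e = v
  generalize alpha p q = a at *
  have hx : (a / q) ^ 2 * q = a / q - p := by
    field_simp; linear_combination hsq
  have hy : (a / p) ^ 2 * p = a / p - q := by
    field_simp; linear_combination hsq
  generalize a / q = x at *
  generalize a / p = y at *
  linear_combination (-π0 * (1 - v) * (p ^ Gc e * q ^ Bc e) * x ^ gap e) * hx
    + ((1 - π0) * v * (p ^ Bc e * q ^ Gc e) * y ^ gap e) * hy

lemma abs_excess_le (hq0 : 0 < q) (hqp : q < p) (hpq1 : p + q < 1) (h0 : 0 < π0)
    (h1 : π0 < 1) (e : Ev) :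
    |excess p q π0 e| ≤ p ^ Gc e * q ^ Bc e + p ^ Bc e * q ^ Gc e := by
  have hp0 : 0 < p := hq0.trans hqp
  have ha := alpha_pos hq0 hp0
  have hα := alpha_lt hq0 hpq1
  have hV1 := V_lt_one hq0 hqp hpq1 h0 h1 e
  have hV0 := V_pos hq0 hqp hpq1 h0 h1 e
  have key : ∀ s t c y : ℝ, 0 < s → s < 1 → 0 < t → t < 1 → 0 < c → alpha p q < y →
      |s * t * c * (1 - (alpha p q / y) ^ (gap e + 1))| ≤ c := by
    intro s t c y hs hs1 ht ht1 hc hy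
    have hy0 : 0 < y := ha.trans hy
    have h2 : (alpha p q / y) ^ (gap e + 1) ≤ 1 :=
      pow_le_one₀ (by positivity) ((div_le_one hy0).2 hy.le)
    have h3 : 0 ≤ (alpha p q / y) ^ (gap e + 1) := by positivity
    rw [abs_of_nonneg (mul_nonneg (by positivity) (by linarith))]
    calc s * t * c * (1 - (alpha p q / y) ^ (gap e + 1))
        ≤ 1 * 1 * c * 1 := by gcongr; linarith
      _ = c := by ring
  refine (abs_sub _ _).trans (add_le_add ?_ ?_)
  · exact key _ _ _ _ h0 h1 (by linarith) (by linarith) (by positivity) hα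
  · exact key _ _ _ _ (by linarith) (by linarith) hV0 hV1 (by positivity) (by linarith)

/-- `wt * (ν - V)` pairs nonpositively with any bounded function that is monotone along
extensions not changing `N`. -/
lemma tsum_wt_mul_nu_sub_V_nonpos (hq0 : 0 < q) (hqp : q < p) (hpq1 : p + q < 1) (h0 : 0 < π0)
    (h1 : π0 < 1) {u : Ev → ℝ} (hu1 : ∀ e, |u e| ≤ 1)
    (hu : ∀ a e, N (a :: e) = N e → u e ≤ u (a :: e)) :
    ∑' e, wt p q π0 e * (nu p q π0 {e} - V p q π0 e) * u e ≤ 0 := by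
  have hp0 : 0 < p := hq0.trans hqp
  have hsC : Summable (excess p q π0) := by
    refine Summable.of_norm_bounded
      ((summable_pow_mul_pow hp0.le hq0.le hpq1).add
        (summable_pow_mul_pow_swap hp0.le hq0.le hpq1)) fun e => ?_
    exact abs_excess_le hq0 hqp hpq1 h0 h1 e
  have hcons : ∀ a : Bool, Function.Injective fun e : Ev => a :: e :=
    fun _ _ _ h => by simpa using h
  have hCu := summable_mul_of_abs_le_one hsC hu1
  have h3 : Summable fun e => excess p q π0 (true :: e) * u e :=
    summable_mul_of_abs_le_one (hsC.comp_injective (hcons true)) hu1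
  have h4 : Summable fun e => excess p q π0 (false :: e) * u e :=
    summable_mul_of_abs_le_one (hsC.comp_injective (hcons false)) hu1
  have h5 : Summable fun e => excess p q π0 (true :: e) * u (true :: e) :=
    hCu.comp_injective (hcons true)
  have h6 : Summable fun e => excess p q π0 (false :: e) * u (false :: e) :=
    hCu.comp_injective (hcons false)
  have hnil : excess p q π0 [] = 0 :=
    excess_eq_zero hq0 hqp hpq1 h0 h1 (by simp [gap, N, D])
  calc ∑' e, wt p q π0 e * (nu p q π0 {e} - V p q π0 e) * u e
      = ∑' e, (excess p q π0 e * u e -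
          (excess p q π0 (true :: e) * u e + excess p q π0 (false :: e) * u e)) := by
        congr 1; ext e; rw [wt_mul_nu_sub_V hq0 hqp hpq1 h0 h1]; ring
    _ = ∑' e, ((excess p q π0 (true :: e) * u (true :: e) +
            excess p q π0 (false :: e) * u (false :: e)) -
          (excess p q π0 (true :: e) * u e + excess p q π0 (false :: e) * u e)) := by
        rw [hCu.tsum_sub (h3.add h4), (h5.add h6).tsum_sub (h3.add h4), tsum_eq_nil_add hCu,
          hnil, zero_mul, zero_add]
    _ ≤ 0 := by
        refine tsum_nonpos fun e => ?_
        have key : ∀ a, excess p q π0 (a :: e) * (u (a :: e) - u e) ≤ 0 := by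
          intro a
          by_cases h : N (a :: e) = N e
          · exact mul_nonpos_of_nonpos_of_nonneg (excess_nonpos hq0 hqp hpq1 h0 h1 _)
              (sub_nonneg.2 (hu a e h))
          · rw [excess_eq_zero hq0 hqp hpq1 h0 h1 (gap_eq_zero_of_N_cons_ne h), zero_mul]
        linarith [key true, key false]

lemma nu_ge_V_iff (hq0 : 0 < q) (hqp : q < p) (hpq1 : p + q < 1) (h0 : 0 < π0) (h1 : π0 < 1)
    (e : Ev) : V p q π0 e ≤ nu p q π0 {e} ↔ (N e : ℝ) - nstar p q ≤ (D e : ℝ) := by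
  have hp0 : 0 < p := hq0.trans hqp
  have hα : 0 < q - alpha p q := sub_pos.2 (alpha_lt hq0 hpq1)
  have hα' : 0 < p - alpha p q := by linarith
  have h1' : 0 < 1 - π0 := by linarith
  have hr : 0 < 1 - p - q := by linarith
  have hlog : 0 < Real.log (p / q) := Real.log_pos ((one_lt_div hq0).2 hqp)
  have hnu : nu p q π0 {e} = π0 * (p ^ Gc e * q ^ Bc e) /
      (π0 * (p ^ Gc e * q ^ Bc e) + (1 - π0) * (p ^ Bc e * q ^ Gc e)) := by
    rw [nu_singleton, wt, FG, FB]
    field_simp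
  rw [hnu, V_eq_div hq0 hqp hpq1 h0 h1, div_le_div_iff₀ (by positivity) (by positivity)]
  have hg := Gc_add_gap e
  have hgap : (gap e : ℝ) = N e - D e := by exact_mod_cast coe_gap e
  generalize (N e).toNat = n at *
  have step : (p / q) ^ (gap e + 1) ≤ (p - alpha p q) / (q - alpha p q) ↔
      (N e : ℝ) - nstar p q ≤ (D e : ℝ) := by
    rw [← Real.log_le_log_iff (by positivity) (by positivity), Real.log_pow, nstar]
    push_cast
    rw [hgap, ← le_div_iff₀ hlog]
    constructor <;> intro h <;> linarith
  rw [← step, div_pow, div_le_div_iff₀ (by positivity) hα]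
  generalize gap e = k at *
  generalize Gc e = G at *
  generalize Bc e = B at *
  have k1 : p ^ (n + 1) * p ^ B = p ^ (k + 1) * p ^ G := by
    rw [← pow_add, ← pow_add]; congr 1; omega
  have k2 : q ^ (n + 1) * q ^ B = q ^ (k + 1) * q ^ G := by
    rw [← pow_add, ← pow_add]; congr 1; omega
  have hc : 0 < π0 * (1 - π0) * (p ^ G * q ^ G) := by positivity
  refine Iff.trans ?_ (mul_le_mul_iff_of_pos_left hc)
  constructor <;> intro h
  · linear_combination h
      - π0 * (1 - π0) * (q - alpha p q) * q ^ G * k1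
      + π0 * (1 - π0) * (p - alpha p q) * p ^ G * k2
  · linear_combination h
      + π0 * (1 - π0) * (q - alpha p q) * q ^ G * k1
      - π0 * (1 - π0) * (p - alpha p q) * p ^ G * k2

end

namespace Eqm

variable {p q π0 : ℝ} (Q : Eqm p q π0)

lemma exists_message (e : Ev) : ∃ m, 0 < Q.σ e m := by
  by_contra! h
  have hz : Q.σ e = 0 := by
    ext m; exact le_antisymm (h m) (Q.σ_nonneg e m)
  have := Q.σ_hasSum e
  rw [hz] at this
  exact one_ne_zero (this.unique hasSum_zero)

lemma σ_le_one (e m : Ev) : Q.σ e m ≤ 1 :=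
  le_hasSum (Q.σ_hasSum e) m fun _ _ => Q.σ_nonneg e _

lemma σ_eq_zero_of_truthful {e m : Ev} (h : Q.σ e e = 1) (hm : e ≠ m) : Q.σ e m = 0 := by
  have := sum_le_hasSum {e, m} (fun _ _ => Q.σ_nonneg e _) (Q.σ_hasSum e)
  rw [Finset.sum_pair hm, h] at this
  exact le_antisymm (by linarith) (Q.σ_nonneg e m)

lemma σ_eq_zero_of_not_suffix {e m : Ev} (h : ¬ m <:+ e) : Q.σ e m = 0 := by
  by_contra hne
  exact h (Q.feasible e m (lt_of_le_of_ne (Q.σ_nonneg e m) (Ne.symm hne)))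

/-- The equilibrium payoff of the sender. -/
noncomputable def val (e : Ev) : ℝ := Q.act (Q.exists_message e).choose

lemma act_le_val {e m : Ev} (h : m <:+ e) : Q.act m ≤ Q.val e :=
  Q.sender_opt e _ (Q.exists_message e).choose_spec m h

lemma act_eq_val {e m : Ev} (h : 0 < Q.σ e m) : Q.act m = Q.val e :=
  le_antisymm (Q.act_le_val (Q.feasible e m h))
    (Q.sender_opt e m h _ (Q.feasible e _ (Q.exists_message e).choose_spec))

lemma val_mono {e e' : Ev} (h : e <:+ e') : Q.val e ≤ Q.val e' :=
  Q.act_le_val ((Q.feasible e _ (Q.exists_message e).choose_spec).trans h)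

lemma val_mem (e : Ev) : Q.val e ∈ Set.Icc (0 : ℝ) 1 := by
  unfold val; rw [Q.receiver_opt]; exact Q.μ_mem _

lemma truthful_of_act_eq_val {e : Ev} (h : Q.act e = Q.val e) : Q.σ e e = 1 :=
  Q.truth_leaning e fun _ hm => h ▸ Q.act_le_val hm

lemma truthful_of_onpath {e m : Ev} (h : 0 < Q.σ e m) : Q.σ m m = 1 :=
  Q.truth_leaning m fun _ hm' =>
    Q.sender_opt e m h _ (hm'.trans (Q.feasible e m h))

lemma val_eq_act_of_truthful {e : Ev} (h : Q.σ e e = 1) : Q.val e = Q.act e :=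
  (Q.act_eq_val (h ▸ one_pos)).symm

/-- Evidence that is not disclosed truthfully is worth less than the sender's payoff. -/
lemma nu_lt_val {e : Ev} (h : Q.σ e e ≠ 1) : nu p q π0 {e} < Q.val e := by
  have hoff : ¬ ∃ e', 0 < Q.σ e' e := fun ⟨_, h'⟩ => h (Q.truthful_of_onpath h')
  rw [← Q.offpath e hoff, ← Q.receiver_opt]
  exact lt_of_le_of_ne (Q.act_le_val List.suffix_rfl) fun h' => h (Q.truthful_of_act_eq_val h')

lemma nu_lt_act {e m : Ev} (hne : e ≠ m) (h : 0 < Q.σ e m) : nu p q π0 {e} < Q.act m := by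
  rw [Q.act_eq_val h]
  exact Q.nu_lt_val fun h1 => h.ne' (Q.σ_eq_zero_of_truthful h1 hne)

lemma summable_σ_mul {g : Ev → ℝ} (hg : Summable g) (m : Ev) :
    Summable fun e => Q.σ e m * g e := by
  refine Summable.of_norm_bounded hg.norm fun e => ?_
  rw [norm_mul, Real.norm_of_nonneg (Q.σ_nonneg e m)]
  exact mul_le_of_le_one_left (norm_nonneg _) (Q.σ_le_one e m)

lemma summable_wt_mul_nu (hq0 : 0 < q) (hp0 : 0 < p) (hpq1 : p + q < 1) (h0 : 0 < π0)
    (h1 : π0 < 1) : Summable fun e => wt p q π0 e * nu p q π0 {e} := by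
  refine Summable.of_nonneg_of_le (fun e => ?_) (fun e => ?_)
    (summable_wt (π0 := π0) hq0 hp0 hpq1)
  · rw [wt_mul_nu hq0 hp0 hpq1 h0 h1]
    have := FG_pos hq0 hp0 hpq1 e
    positivity
  · rw [wt_mul_nu hq0 hp0 hpq1 h0 h1, wt]
    have := mul_pos (FB_pos hq0 hp0 hpq1 e) (sub_pos.2 h1)
    linarith

lemma summable_wt_mul_nu_sub (hq0 : 0 < q) (hp0 : 0 < p) (hpq1 : p + q < 1) (h0 : 0 < π0)
    (h1 : π0 < 1) (c : ℝ) : Summable fun e => wt p q π0 e * (nu p q π0 {e} - c) := by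
  simpa only [mul_sub] using (summable_wt_mul_nu hq0 hp0 hpq1 h0 h1).sub
    ((summable_wt hq0 hp0 hpq1).mul_right c)

/-- Bayes' rule as a balance condition. -/
lemma tsum_σ_mul_eq_zero (hq0 : 0 < q) (hp0 : 0 < p) (hpq1 : p + q < 1) (h0 : 0 < π0)
    (h1 : π0 < 1) (m : Ev) :
    ∑' e, Q.σ e m * (wt p q π0 e * (nu p q π0 {e} - Q.act m)) = 0 := by
  by_cases hm : ∃ e, 0 < Q.σ e m
  · have hw := summable_wt (π0 := π0) hq0 hp0 hpq1
    have hsub : ∀ g : Ev → ℝ, ∑' e : {e : Ev // m <:+ e}, Q.σ e.1 m * g e.1 =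
        ∑' e, Q.σ e m * g e := by
      intro g
      refine tsum_subtype_eq_of_support_subset (f := fun e => Q.σ e m * g e)
        (s := {e : Ev | m <:+ e}) fun e he => ?_
      by_contra hne
      exact he (by simp [Q.σ_eq_zero_of_not_suffix hne])
    have hb := Q.bayes m hm
    simp only [mul_assoc (Q.σ _ m) (FG p q _) π0] at hb
    rw [hsub fun e => FG p q e * π0, hsub fun e => FG p q e * π0 + FB p q e * (1 - π0),
      ← Q.receiver_opt] at hb
    change Q.act m = _ / ∑' e, Q.σ e m * wt p q π0 e at hb
    obtain ⟨e0, he0⟩ := hm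
    have hpos : 0 < ∑' e, Q.σ e m * wt p q π0 e :=
      (Q.summable_σ_mul hw m).tsum_pos
        (fun e => mul_nonneg (Q.σ_nonneg e m) (wt_pos hq0 hp0 hpq1 h0 h1 e).le) e0
        (mul_pos he0 (wt_pos hq0 hp0 hpq1 h0 h1 e0))
    rw [eq_div_iff hpos.ne'] at hb
    have hsplit : ∀ e, Q.σ e m * (wt p q π0 e * (nu p q π0 {e} - Q.act m)) =
        Q.σ e m * (wt p q π0 e * nu p q π0 {e}) - Q.act m * (Q.σ e m * wt p q π0 e) :=
      fun e => by ring
    simp only [hsplit]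
    rw [(Q.summable_σ_mul (summable_wt_mul_nu hq0 hp0 hpq1 h0 h1) m).tsum_sub
      ((Q.summable_σ_mul hw m).mul_left _), tsum_mul_left, hb]
    simp only [wt_mul_nu hq0 hp0 hpq1 h0 h1, sub_self]
  · have hz : ∀ e, Q.σ e m = 0 := fun e =>
      le_antisymm (not_lt.1 fun h => hm ⟨e, h⟩) (Q.σ_nonneg e m)
    simp [hz]

lemma truthful_iff (hq0 : 0 < q) (hp0 : 0 < p) (hpq1 : p + q < 1) (h0 : 0 < π0)
    (h1 : π0 < 1) (e : Ev) : Q.σ e e = 1 ↔ Q.val e ≤ nu p q π0 {e} := by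
  refine ⟨fun h => ?_, fun h => by_contra fun h' => (Q.nu_lt_val h').not_ge h⟩
  rw [Q.val_eq_act_of_truthful h]
  by_contra! hlt
  have hs := Q.summable_σ_mul (summable_wt_mul_nu_sub hq0 hp0 hpq1 h0 h1 (Q.act e)) e
  have hneg : ∑' e', Q.σ e' e * (wt p q π0 e' * (nu p q π0 {e'} - Q.act e)) < ∑' _ : Ev, 0 := by
    refine hs.tsum_lt_tsum (i := e) (fun e' => ?_) ?_ summable_zero
    · rcases (Q.σ_nonneg e' e).eq_or_lt with hz | hz
      · simp [← hz]
      · have : nu p q π0 {e'} < Q.act e := by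
          rcases eq_or_ne e' e with rfl | hne
          · exact hlt
          · exact Q.nu_lt_act hne hz
        exact mul_nonpos_of_nonneg_of_nonpos hz.le (mul_nonpos_of_nonneg_of_nonpos
          (wt_pos hq0 hp0 hpq1 h0 h1 e').le (by linarith))
    · rw [h, one_mul]
      exact mul_neg_of_pos_of_neg (wt_pos hq0 hp0 hpq1 h0 h1 e) (by linarith)
  rw [Q.tsum_σ_mul_eq_zero hq0 hp0 hpq1 h0 h1, tsum_zero] at hneg
  exact lt_irrefl _ hneg

/-- `wt * (ν - val)` pairs nonpositively with `u - val` for every bounded monotone `u`. -/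
lemma tsum_wt_mul_nu_sub_val_nonpos (hq0 : 0 < q) (hp0 : 0 < p) (hpq1 : p + q < 1)
    (h0 : 0 < π0) (h1 : π0 < 1) {u : Ev → ℝ} (hu1 : ∀ e, u e ∈ Set.Icc (0 : ℝ) 1)
    (hu : ∀ m e, m <:+ e → u m ≤ u e) :
    ∑' e, wt p q π0 e * (nu p q π0 {e} - Q.val e) * (u e - Q.val e) ≤ 0 := by
  have hw := summable_wt (π0 := π0) hq0 hp0 hpq1
  have hwpos := wt_pos (π0 := π0) hq0 hp0 hpq1 h0 h1
  have hnu : ∀ e, nu p q π0 {e} ∈ Set.Icc (0 : ℝ) 1 := by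
    intro e
    have hG := mul_pos (FG_pos hq0 hp0 hpq1 e) h0
    have hB := mul_pos (FB_pos hq0 hp0 hpq1 e) (sub_pos.2 h1)
    rw [nu_singleton]
    refine ⟨div_nonneg hG.le (hwpos e).le, (div_le_one (hwpos e)).2 ?_⟩
    unfold wt; linarith
  have hact : ∀ m, Q.act m ∈ Set.Icc (0 : ℝ) 1 := fun m => Q.receiver_opt m ▸ Q.μ_mem m
  have hsum : Summable fun x : Ev × Ev => Q.σ x.1 x.2 * wt p q π0 x.1 := by
    have hnn : 0 ≤ fun x : Ev × Ev => Q.σ x.1 x.2 * wt p q π0 x.1 :=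
      fun x => mul_nonneg (Q.σ_nonneg _ _) (hwpos _).le
    refine (summable_prod_of_nonneg hnn).2 ⟨fun e => ?_, ?_⟩
    · exact (Q.σ_hasSum e).summable.mul_right (wt p q π0 e)
    · refine hw.congr fun e => ?_
      dsimp only
      rw [tsum_mul_right, (Q.σ_hasSum e).tsum_eq, one_mul]
  have hbdd : ∀ r s : Ev → Ev → ℝ, (∀ e m, |r e m| ≤ 1) → (∀ e m, |s e m| ≤ 1) →
      Summable (Function.uncurry fun e m => Q.σ e m * wt p q π0 e * (r e m * s e m)) := by
    intro r s hr hs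
    refine Summable.of_norm_bounded hsum fun x => ?_
    simp only [Function.uncurry, norm_mul, Real.norm_of_nonneg (Q.σ_nonneg _ _),
      Real.norm_of_nonneg (hwpos _).le]
    exact mul_le_of_le_one_right (mul_nonneg (Q.σ_nonneg _ _) (hwpos _).le)
      (mul_le_one₀ (hr _ _) (norm_nonneg _) (hs _ _))
  have hS1 := hbdd (fun e m => nu p q π0 {e} - Q.act m) (fun e m => u e - Q.act m)
    (fun e m => abs_sub_le_one_of_mem_Icc (hnu e) (hact m))
    (fun e m => abs_sub_le_one_of_mem_Icc (hu1 e) (hact m))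
  have hS2 := hbdd (fun e m => nu p q π0 {e} - Q.act m) (fun _ m => u m - Q.act m)
    (fun e m => abs_sub_le_one_of_mem_Icc (hnu e) (hact m))
    (fun _ m => abs_sub_le_one_of_mem_Icc (hu1 m) (hact m))
  calc ∑' e, wt p q π0 e * (nu p q π0 {e} - Q.val e) * (u e - Q.val e)
      = ∑' e, ∑' m, Q.σ e m * wt p q π0 e *
          ((nu p q π0 {e} - Q.act m) * (u e - Q.act m)) := by
        refine tsum_congr fun e => ?_
        have : ∀ m, Q.σ e m * wt p q π0 e * ((nu p q π0 {e} - Q.act m) * (u e - Q.act m)) =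
            Q.σ e m * (wt p q π0 e * (nu p q π0 {e} - Q.val e) * (u e - Q.val e)) := by
          intro m
          rcases (Q.σ_nonneg e m).eq_or_lt with hz | hz
          · simp [← hz]
          · rw [Q.act_eq_val hz]; ring
        simp only [this]
        rw [tsum_mul_right, (Q.σ_hasSum e).tsum_eq, one_mul]
    _ = ∑' x : Ev × Ev, Q.σ x.1 x.2 * wt p q π0 x.1 *
          ((nu p q π0 {x.1} - Q.act x.2) * (u x.1 - Q.act x.2)) := (hS1.tsum_prod).symm
    _ ≤ ∑' x : Ev × Ev, Q.σ x.1 x.2 * wt p q π0 x.1 *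
          ((nu p q π0 {x.1} - Q.act x.2) * (u x.2 - Q.act x.2)) := by
        refine Summable.tsum_le_tsum (fun ⟨e, m⟩ => ?_) hS1 hS2
        rcases (Q.σ_nonneg e m).eq_or_lt with hz | hz
        · simp [← hz]
        rcases eq_or_ne e m with rfl | hne
        · exact le_rfl
        · refine mul_le_mul_of_nonneg_left ?_ (mul_nonneg hz.le (hwpos e).le)
          exact mul_le_mul_of_nonpos_left
            (sub_le_sub_right (hu m e (Q.feasible e m hz)) _)
            (sub_nonpos.2 (Q.nu_lt_act hne hz).le)
    _ = ∑' e, ∑' m, Q.σ e m * wt p q π0 e *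
          ((nu p q π0 {e} - Q.act m) * (u m - Q.act m)) := hS2.tsum_prod
    _ = ∑' m, ∑' e, Q.σ e m * wt p q π0 e *
          ((nu p q π0 {e} - Q.act m) * (u m - Q.act m)) := (hS2.tsum_comm).symm
    _ = ∑' m, (∑' e, Q.σ e m * (wt p q π0 e * (nu p q π0 {e} - Q.act m))) *
          (u m - Q.act m) := by
        refine tsum_congr fun m => ?_
        rw [← tsum_mul_right]
        exact tsum_congr fun e => by ring
    _ = 0 := by simp [Q.tsum_σ_mul_eq_zero hq0 hp0 hpq1 h0 h1]
    _ ≤ 0 := le_rfl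

/-- The equilibrium payoff is `V`: both are the `wt`-weighted isotonic regression of `ν`. -/
lemma val_eq_V (hq0 : 0 < q) (hqp : q < p) (hpq1 : p + q < 1) (h0 : 0 < π0) (h1 : π0 < 1)
    (e : Ev) : Q.val e = V p q π0 e := by
  have hp0 : 0 < p := hq0.trans hqp
  have hw := summable_wt (π0 := π0) hq0 hp0 hpq1
  have hwpos := wt_pos (π0 := π0) hq0 hp0 hpq1 h0 h1
  have hV : ∀ e, V p q π0 e ∈ Set.Icc (0 : ℝ) 1 := fun e =>
    ⟨(V_pos hq0 hqp hpq1 h0 h1 e).le, (V_lt_one hq0 hqp hpq1 h0 h1 e).le⟩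
  have hwnu := summable_wt_mul_nu (π0 := π0) hq0 hp0 hpq1 h0 h1
  have hsub : ∀ w : Ev → ℝ, (∀ e, w e ∈ Set.Icc (0 : ℝ) 1) →
      Summable fun e => wt p q π0 e * (nu p q π0 {e} - w e) := by
    intro w hw1
    simpa only [mul_sub] using
      hwnu.sub (summable_mul_of_abs_le_one hw fun e => by
        rw [abs_of_nonneg (hw1 e).1]; exact (hw1 e).2)
  have i1 := Q.tsum_wt_mul_nu_sub_val_nonpos hq0 hp0 hpq1 h0 h1 hV
    fun m e h => V_mono hq0 hqp hpq1 h0 h1 h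
  have i2 := tsum_wt_mul_nu_sub_V_nonpos hq0 hqp hpq1 h0 h1
    (u := fun e => Q.val e - V p q π0 e) (fun e => abs_sub_le_one_of_mem_Icc (Q.val_mem e) (hV e))
    fun a e h => by
      rw [V_congr h]
      exact sub_le_sub_right (Q.val_mono (List.suffix_cons a e)) _
  have s1 : Summable fun e => wt p q π0 e * (nu p q π0 {e} - Q.val e) *
      (V p q π0 e - Q.val e) :=
    summable_mul_of_abs_le_one (hsub _ Q.val_mem) fun e =>
      abs_sub_le_one_of_mem_Icc (hV e) (Q.val_mem e)
  have s2 : Summable fun e => wt p q π0 e * (nu p q π0 {e} - V p q π0 e) *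
      (Q.val e - V p q π0 e) :=
    summable_mul_of_abs_le_one (hsub _ hV) fun e =>
      abs_sub_le_one_of_mem_Icc (Q.val_mem e) (hV e)
  have hsum := s1.tsum_add s2
  have hnn : ∀ e, 0 ≤ wt p q π0 e * (Q.val e - V p q π0 e) ^ 2 := fun e =>
    mul_nonneg (hwpos e).le (sq_nonneg _)
  have heq : ∀ e, wt p q π0 e * (nu p q π0 {e} - Q.val e) * (V p q π0 e - Q.val e) +
      wt p q π0 e * (nu p q π0 {e} - V p q π0 e) * (Q.val e - V p q π0 e) =
      wt p q π0 e * (Q.val e - V p q π0 e) ^ 2 := fun e => by ring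
  have hsq : Summable fun e => wt p q π0 e * (Q.val e - V p q π0 e) ^ 2 :=
    (s1.add s2).congr heq
  simp only [heq] at hsum
  have hle := hsq.le_tsum e fun e' _ => hnn e'
  have hz : wt p q π0 e * (Q.val e - V p q π0 e) ^ 2 = 0 :=
    le_antisymm (by linarith) (hnn e)
  have := (mul_eq_zero.1 hz).resolve_left (hwpos e).ne'
  exact sub_eq_zero.1 (pow_eq_zero_iff two_ne_zero |>.1 this)

end Eqm

/-- Proposition 5(2): in every truth-leaning equilibrium of the left-censored
model, the sender discloses truthfully at `e` (i.e. `σ(e|e) = 1`) iff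
`D(e) ≥ N(e) − n*`. -/
theorem stmt_15 (p q π0 : ℝ) (hq0 : 0 < q) (hqp : q < p) (hp1 : p < 1)
    (hpq0 : 0 < p + q) (hpq1 : p + q < 1) (h0 : 0 < π0) (h1 : π0 < 1)
    (Q : Eqm p q π0) :
    ∀ e : Ev, (Q.σ e e = 1 ↔ (N e : ℝ) - nstar p q ≤ (D e : ℝ)) := by
  intro e
  rw [Q.truthful_iff hq0 (hq0.trans hqp) hpq1 h0 h1, Q.val_eq_V hq0 hqp hpq1 h0 h1,
    nu_ge_V_iff hq0 hqp hpq1 h0 h1]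

end LeftCensored
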